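/- Let e₁, e₂ be two noncrossing arcs joining points u, v ∈ ℝ², and let e₁', e₂' be two noncrossing arcs joining points u', v' ∈ ℝ², where each arc is a continuous injective map [0,1] → ℝ² whose interior avoids all four points u, v, u', v', and {u, v} ∩ {u', v'} = ∅. Assume that any two of the four arcs share at most one common interior point. Let ℓ be a bounded connected component of the complement of e₁ ∪ e₂, and let ℓ' be a bounded connected component of the complement of e₁' ∪ e₂'. Suppose that ℓ contains neither u' nor v', that ℓ' contains neither u nor v, and that ℓ ∩ ℓ' ≠ ∅. Then each of the arcs e₁, e₂ crosses (shares an interior point with) each of the arcs e₁', e₂'. -/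

import Mathlib

open Set

/-- The interior of an arc `γ : [0,1] → ℝ²`: the image of the open interval `(0,1)`. -/
def arcInt (γ : unitInterval → ℝ × ℝ) : Set (ℝ × ℝ) :=
  γ '' {t : unitInterval | t ≠ 0 ∧ t ≠ 1}

/-- Two arcs cross if their interiors share a common point. -/
def ArcsCross (γ δ : unitInterval → ℝ × ℝ) : Prop := (arcInt γ ∩ arcInt δ).Nonempty

/-- The identification of the plane with the complex numbers. -/
noncomputable def toC (p : ℝ × ℝ) : ℂ := (p.1 : ℂ) + (p.2 : ℂ) * Complex.I

theorem continuous_toC : Continuous toC := by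
  unfold toC; fun_prop

theorem toC_injective : Function.Injective toC := by
  intro p q h
  have h1 := congrArg Complex.re h
  have h2 := congrArg Complex.im h
  simp [toC] at h1 h2
  exact Prod.ext h1 h2

/-- `z - x` has a continuous logarithm on `K`. -/
def HasLog (x : ℝ × ℝ) (K : Set (ℝ × ℝ)) : Prop :=
  ∃ L : ℝ × ℝ → ℂ, ContinuousOn L K ∧ ∀ z ∈ K, Complex.exp (L z) = toC z - toC x

theorem HasLog.mono {x : ℝ × ℝ} {K K' : Set (ℝ × ℝ)} (h : HasLog x K) (hK : K' ⊆ K) :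
    HasLog x K' := by
  obtain ⟨L, hL, hE⟩ := h
  exact ⟨L, hL.mono hK, fun z hz => hE z (hK hz)⟩

/-- Logarithms glue along at most one point. -/
theorem HasLog.union {x : ℝ × ℝ} {A B : Set (ℝ × ℝ)} (hA : HasLog x A) (hB : HasLog x B)
    (cA : IsClosed A) (cB : IsClosed B) (hs : (A ∩ B).Subsingleton) : HasLog x (A ∪ B) := by
  classical
  obtain ⟨L, hL, hE⟩ := hA
  obtain ⟨M, hM, hF⟩ := hB
  obtain ⟨c, hc, hcAB⟩ : ∃ c : ℂ, Complex.exp c = 1 ∧ ∀ z ∈ A ∩ B, L z = M z + c := by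
    by_cases hne : (A ∩ B).Nonempty
    · obtain ⟨p, hp⟩ := hne
      refine ⟨L p - M p, ?_, ?_⟩
      · rw [Complex.exp_sub, hE p hp.1, hF p hp.2, ← hE p hp.1]
        exact div_self (Complex.exp_ne_zero _)
      · intro z hz
        rw [hs hz hp]; ring
    · exact ⟨0, Complex.exp_zero, fun z hz => (hne ⟨z, hz⟩).elim⟩
  have e1 : EqOn (A.piecewise L (fun z => M z + c)) L A := fun z hz => by simp [hz]
  have e2 : EqOn (A.piecewise L (fun z => M z + c)) (fun z => M z + c) B := fun z hz => by
    by_cases hzA : z ∈ A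
    · simp [hzA, hcAB z ⟨hzA, hz⟩]
    · simp [hzA]
  refine ⟨A.piecewise L (fun z => M z + c), ?_, ?_⟩
  · refine ContinuousOn.union_of_isClosed (hL.congr e1) ?_ cA cB
    exact ContinuousOn.congr (hM.add continuousOn_const) e2
  · rintro z (hz | hz)
    · rw [e1 hz, hE z hz]
    · rw [e2 hz]
      simp only [Complex.exp_add, hc, hF z hz, mul_one]

/-- Nonvanishing continuous functions on nice spaces have logarithms. -/
theorem exists_clog {A : Type*} [TopologicalSpace A] [SimplyConnectedSpace A]
    [LocallyPathConnectedSpace A] (f : A → ℂ) (hf : Continuous f) (h0 : ∀ a, f a ≠ 0) :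
    ∃ G : A → ℂ, Continuous G ∧ ∀ a, Complex.exp (G a) = f a := by
  obtain ⟨a₀⟩ : Nonempty A := inferInstance
  obtain ⟨F, ⟨-, hF⟩, -⟩ := Complex.isCoveringMapOn_exp.existsUnique_continuousMap_lifts
    (⟨f, hf⟩ : C(A, ℂ)) (a₀ := a₀) (e₀ := Complex.log (f a₀)) (Complex.exp_log (h0 a₀))
    (fun a => by simpa using h0 a)
  exact ⟨F, F.continuous, fun a => congrFun hF a⟩

theorem hasLog_arc {x : ℝ × ℝ} {γ : unitInterval → ℝ × ℝ} (hc : Continuous γ)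
    (hi : Function.Injective γ) (hx : x ∉ range γ) : HasLog x (range γ) := by
  have : ContractibleSpace unitInterval :=
    (convex_Icc (0:ℝ) 1).contractibleSpace ⟨0, by simp⟩
  have : SimplyConnectedSpace unitInterval := SimplyConnectedSpace.ofContractible _
  have : LocallyPathConnectedSpace unitInterval :=
    (convex_Icc (0:ℝ) 1).locallyPathConnectedSpace
  obtain ⟨G, hG, hE⟩ := exists_clog (fun t => toC (γ t) - toC x)
    ((continuous_toC.comp hc).sub continuous_const) (fun t h => hx
      ⟨t, toC_injective (sub_eq_zero.1 h)⟩)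
  have hemb : Topology.IsClosedEmbedding γ := hc.isClosedEmbedding hi
  obtain ⟨g, hg⟩ := (⟨G, hG⟩ : C(unitInterval, ℂ)).exists_extension' hemb
  refine ⟨g, g.continuous.continuousOn, ?_⟩
  rintro _ ⟨t, rfl⟩
  rw [show g (γ t) = G t from congrFun hg t, hE t]

theorem no_log_far (x : ℝ × ℝ) (R : ℝ) (hR : 0 < R) (G : ℝ × ℝ → ℂ) (hG : Continuous G)
    (h : ∀ θ : ℝ, Complex.exp (G (x.1 + R * Real.cos θ, x.2 + R * Real.sin θ)) =
      R * Complex.exp (θ * Complex.I)) : False := by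
  let c : ℝ → ℂ := fun θ => G (x.1 + R * Real.cos θ, x.2 + R * Real.sin θ)
  have hc : Continuous c := hG.comp (by fun_prop)
  let d : ℝ → ℂ := fun θ => c 0 + θ * Complex.I
  have hd : Continuous d := by fun_prop
  have h0 : Complex.exp (c 0) = R := by simpa [c] using h 0
  have key : c = d := by
    refine Complex.isCoveringMap_exp.eq_of_comp_eq hc hd ?_ 0 (by simp [d])
    funext θ
    refine Subtype.ext ?_
    change Complex.exp (c θ) = Complex.exp (c 0 + θ * Complex.I)
    rw [Complex.exp_add, h0]
    exact h θ
  have e1 := congrFun key (2 * Real.pi)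
  have e2 : c (2 * Real.pi) = c 0 := by simp [c]
  rw [e2] at e1
  simp [d, Real.pi_ne_zero] at e1

/-- Borsuk: the frontier of a bounded open set around `x` carries no logarithm of `z - x`. -/
theorem no_log_frontier {x : ℝ × ℝ} {F : Set (ℝ × ℝ)} (hF : IsOpen F)
    (hb : Bornology.IsBounded F) (hx : x ∈ F) : ¬ HasLog x (frontier F) := by
  classical
  rintro ⟨L, hL, hE⟩
  obtain ⟨g, hg⟩ := ContinuousMap.exists_restrict_eq (isClosed_frontier (s := F))
    (⟨(frontier F).domRestrict L, hL.domRestrict⟩ : C(frontier F, ℂ))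
  have hg' : ∀ z ∈ frontier F, g z = L z := fun z hz =>
    congrArg (fun f : C(frontier F, ℂ) => f ⟨z, hz⟩) hg
  let f : ℝ × ℝ → ℂ := F.piecewise (fun z => Complex.exp (g z)) (fun z => toC z - toC x)
  have hf : Continuous f := by
    refine Continuous.piecewise ?_ (Complex.continuous_exp.comp g.continuous)
      (continuous_toC.sub continuous_const)
    intro z hz
    rw [hg' z hz, hE z hz]
  have h0 : ∀ z, f z ≠ 0 := by
    intro z
    by_cases hz : z ∈ F
    · simp [f, hz]
    · simp only [f, hz, not_false_eq_true, piecewise_eq_of_notMem]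
      intro h
      rw [toC_injective (sub_eq_zero.1 h)] at hz
      exact hz hx
  obtain ⟨G, hG, hGf⟩ := exists_clog f hf h0
  obtain ⟨r, hr, hFr⟩ := hb.subset_ball_lt 0 x
  refine no_log_far x (2 * r) (by positivity) G hG ?_
  intro θ
  have hout : (x.1 + 2 * r * Real.cos θ, x.2 + 2 * r * Real.sin θ) ∉ F := by
    intro hin
    have := hFr hin
    rw [Metric.mem_ball, Prod.dist_eq, max_lt_iff, Real.dist_eq, Real.dist_eq] at this
    obtain ⟨h1, h2⟩ := this
    simp only [add_sub_cancel_left] at h1 h2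
    have h1' := sq_lt_sq' (abs_lt.1 h1).1 (abs_lt.1 h1).2
    have h2' := sq_lt_sq' (abs_lt.1 h2).1 (abs_lt.1 h2).2
    nlinarith [Real.sin_sq_add_cos_sq θ, sq_pos_of_pos hr]
  rw [hGf]
  simp only [f, hout, not_false_eq_true, piecewise_eq_of_notMem]
  rw [Complex.exp_mul_I]
  simp only [toC]
  push_cast
  ring

theorem mem_arcInt_of {γ : unitInterval → ℝ × ℝ} {z : ℝ × ℝ} (hz : z ∈ range γ)
    (h0 : z ≠ γ 0) (h1 : z ≠ γ 1) : z ∈ arcInt γ := by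
  obtain ⟨t, rfl⟩ := hz
  exact ⟨t, ⟨fun h => h0 (by rw [h]), fun h => h1 (by rw [h])⟩, rfl⟩

/-- If the four arcs cross at most along a path `a - b' - b - a'`, their union cannot bound `F`. -/
theorem lens_core (a b a' b' : unitInterval → ℝ × ℝ) (x : ℝ × ℝ) (F : Set (ℝ × ℝ))
    (ca : Continuous a) (cb : Continuous b) (ca' : Continuous a') (cb' : Continuous b')
    (ia : Function.Injective a) (ib : Function.Injective b)
    (ia' : Function.Injective a') (ib' : Function.Injective b')
    (hF : IsOpen F) (hb : Bornology.IsBounded F) (hx : x ∈ F)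
    (xa : x ∉ range a) (xb : x ∉ range b) (xa' : x ∉ range a') (xb' : x ∉ range b')
    (ha : range a ∩ frontier F ⊆ arcInt a) (hbb : range b ∩ frontier F ⊆ arcInt b)
    (ha' : range a' ∩ frontier F ⊆ arcInt a') (hb' : range b' ∩ frontier F ⊆ arcInt b')
    (hfr : frontier F ⊆ range a ∪ range b ∪ (range a' ∪ range b'))
    (hab : Disjoint (arcInt a) (arcInt b)) (hab' : Disjoint (arcInt a') (arcInt b'))
    (s1 : (arcInt a ∩ arcInt b').Subsingleton) (s2 : (arcInt b ∩ arcInt b').Subsingleton)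
    (s3 : (arcInt b ∩ arcInt a').Subsingleton) : ArcsCross a a' := by
  by_contra hno
  have hno' : ∀ z, z ∈ arcInt a → z ∈ arcInt a' → False := fun z h1 h2 => hno ⟨z, h1, h2⟩
  have hfc := isClosed_frontier (s := F)
  have cl : ∀ {γ : unitInterval → ℝ × ℝ}, Continuous γ → IsClosed (range γ ∩ frontier F) :=
    fun h => (isCompact_range h).isClosed.inter hfc
  have la := (hasLog_arc ca ia xa).mono (inter_subset_left (t := frontier F))
  have lb := (hasLog_arc cb ib xb).mono (inter_subset_left (t := frontier F))
  have la' := (hasLog_arc ca' ia' xa').mono (inter_subset_left (t := frontier F))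
  have lb' := (hasLog_arc cb' ib' xb').mono (inter_subset_left (t := frontier F))
  have l1 := la.union lb' (cl ca) (cl cb')
    (fun p hp q hq => s1 ⟨ha hp.1, hb' hp.2⟩ ⟨ha hq.1, hb' hq.2⟩)
  have c1 := (cl ca).union (cl cb')
  have l2 := l1.union lb c1 (cl cb) (by
    have : ∀ p, p ∈ (range a ∩ frontier F ∪ range b' ∩ frontier F) ∩ (range b ∩ frontier F) →
        p ∈ arcInt b ∩ arcInt b' := by
      rintro p ⟨hp | hp, hp2⟩
      · exact (disjoint_left.1 hab (ha hp) (hbb hp2)).elim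
      · exact ⟨hbb hp2, hb' hp⟩
    exact fun p hp q hq => s2 (this p hp) (this q hq))
  have l3 := l2.union la' (c1.union (cl cb)) (cl ca') (by
    have : ∀ p, p ∈ (range a ∩ frontier F ∪ range b' ∩ frontier F ∪ range b ∩ frontier F) ∩
        (range a' ∩ frontier F) → p ∈ arcInt b ∩ arcInt a' := by
      rintro p ⟨(hp | hp) | hp, hp2⟩
      · exact (hno' p (ha hp) (ha' hp2)).elim
      · exact (disjoint_left.1 hab' (ha' hp2) (hb' hp)).elim
      · exact ⟨hbb hp, ha' hp2⟩
    exact fun p hp q hq => s3 (this p hp) (this q hq))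
  refine no_log_frontier hF hb hx (l3.mono ?_)
  intro z hz
  rcases hfr hz with (h | h) | (h | h)
  · exact Or.inl (Or.inl (Or.inl ⟨h, hz⟩))
  · exact Or.inl (Or.inr ⟨h, hz⟩)
  · exact Or.inr ⟨h, hz⟩
  · exact Or.inl (Or.inl (Or.inr ⟨h, hz⟩))

/-- A point off a closed set `K` and off a component of its complement is off its closure. -/
theorem closure_component {K : Set (ℝ × ℝ)} (hK : IsClosed K) {x p : ℝ × ℝ}
    (hp : p ∈ closure (connectedComponentIn Kᶜ x)) :
    p ∈ K ∨ p ∈ connectedComponentIn Kᶜ x := by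
  by_cases hpK : p ∈ K
  · exact Or.inl hpK
  right
  have ho : IsOpen (connectedComponentIn Kᶜ p) := hK.isOpen_compl.connectedComponentIn
  have hpm : p ∈ connectedComponentIn Kᶜ p := mem_connectedComponentIn hpK
  obtain ⟨y, hy1, hy2⟩ := mem_closure_iff.1 hp _ ho hpm
  rw [connectedComponentIn_eq hy2, ← connectedComponentIn_eq hy1]
  exact hpm

theorem mem_range_cases {γ : unitInterval → ℝ × ℝ} {u v z : ℝ × ℝ}
    (hend : ({γ 0, γ 1} : Set (ℝ × ℝ)) = {u, v}) (hz : z ∈ range γ) :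
    z ∈ arcInt γ ∨ z = u ∨ z = v := by
  by_cases h0 : z = γ 0
  · right
    have : z ∈ ({γ 0, γ 1} : Set (ℝ × ℝ)) := by simp [h0]
    rw [hend] at this; simpa using this
  by_cases h1 : z = γ 1
  · right
    have : z ∈ ({γ 0, γ 1} : Set (ℝ × ℝ)) := by simp [h1]
    rw [hend] at this; simpa using this
  exact Or.inl (mem_arcInt_of hz h0 h1)

/-- **Lemma 3 (geometric observation).** Let `e₁, e₂` be noncrossing arcs joining `u, v` and
`e₁', e₂'` noncrossing arcs joining `u', v'`, with `{u,v} ∩ {u',v'} = ∅`, the interior of each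
arc avoiding all four points, and any two of the four arcs sharing at most one common interior
point. If `ℓ` is a bounded connected component of the complement of `e₁ ∪ e₂` containing
neither `u'` nor `v'`, and `ℓ'` is a bounded connected component of the complement of
`e₁' ∪ e₂'` containing neither `u` nor `v`, and `ℓ ∩ ℓ' ≠ ∅`, then each of `e₁, e₂` crosses
each of `e₁', e₂'`. -/
theorem lens_lens_crossing
    (u v u' v' : ℝ × ℝ)
    (e₁ e₂ e₁' e₂' : unitInterval → ℝ × ℝ)
    (hc₁ : Continuous e₁) (hc₂ : Continuous e₂)
    (hc₁' : Continuous e₁') (hc₂' : Continuous e₂')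
    (hi₁ : Function.Injective e₁) (hi₂ : Function.Injective e₂)
    (hi₁' : Function.Injective e₁') (hi₂' : Function.Injective e₂')
    (hend₁ : ({e₁ 0, e₁ 1} : Set (ℝ × ℝ)) = {u, v})
    (hend₂ : ({e₂ 0, e₂ 1} : Set (ℝ × ℝ)) = {u, v})
    (hend₁' : ({e₁' 0, e₁' 1} : Set (ℝ × ℝ)) = {u', v'})
    (hend₂' : ({e₂' 0, e₂' 1} : Set (ℝ × ℝ)) = {u', v'})
    (havoid : ∀ γ ∈ ({e₁, e₂, e₁', e₂'} : Set (unitInterval → ℝ × ℝ)),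
      ∀ p ∈ ({u, v, u', v'} : Set (ℝ × ℝ)), p ∉ arcInt γ)
    (hdisj : Disjoint ({u, v} : Set (ℝ × ℝ)) ({u', v'} : Set (ℝ × ℝ)))
    (hnc : Disjoint (arcInt e₁) (arcInt e₂))
    (hnc' : Disjoint (arcInt e₁') (arcInt e₂'))
    (hone : ∀ γ ∈ ({e₁, e₂, e₁', e₂'} : Set (unitInterval → ℝ × ℝ)),
      ∀ δ ∈ ({e₁, e₂, e₁', e₂'} : Set (unitInterval → ℝ × ℝ)),
        γ ≠ δ → (arcInt γ ∩ arcInt δ).Subsingleton)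
    (ℓ ℓ' : Set (ℝ × ℝ))
    (hℓbd : Bornology.IsBounded ℓ)
    (hℓ : ∃ x ∈ (Set.range e₁ ∪ Set.range e₂)ᶜ,
      ℓ = connectedComponentIn (Set.range e₁ ∪ Set.range e₂)ᶜ x)
    (hℓ'bd : Bornology.IsBounded ℓ')
    (hℓ' : ∃ x ∈ (Set.range e₁' ∪ Set.range e₂')ᶜ,
      ℓ' = connectedComponentIn (Set.range e₁' ∪ Set.range e₂')ᶜ x)
    (hu'ℓ : u' ∉ ℓ) (hv'ℓ : v' ∉ ℓ) (huℓ' : u ∉ ℓ') (hvℓ' : v ∉ ℓ')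
    (hmeet : (ℓ ∩ ℓ').Nonempty) :
    ArcsCross e₁ e₁' ∧ ArcsCross e₁ e₂' ∧ ArcsCross e₂ e₁' ∧ ArcsCross e₂ e₂' := by
  obtain ⟨x₁, hx₁, rfl⟩ := hℓ
  obtain ⟨x₂, hx₂, rfl⟩ := hℓ'
  obtain ⟨x, hxℓ, hxℓ'⟩ := hmeet
  have hK : IsClosed (range e₁ ∪ range e₂) :=
    (isCompact_range hc₁).isClosed.union (isCompact_range hc₂).isClosed
  have hK' : IsClosed (range e₁' ∪ range e₂') :=
    (isCompact_range hc₁').isClosed.union (isCompact_range hc₂').isClosed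
  have hxK := connectedComponentIn_subset _ _ hxℓ
  have hxK' := connectedComponentIn_subset _ _ hxℓ'
  simp only [mem_compl_iff, mem_union, not_or] at hxK hxK'
  simp only [mem_insert_iff, mem_singleton_iff, forall_eq_or_imp, forall_eq] at havoid
  obtain ⟨⟨_, _, a13, a14⟩, ⟨_, _, a23, a24⟩, ⟨a31, a32, _, _⟩, ⟨a41, a42, _, _⟩⟩ := havoid
  simp only [disjoint_left, mem_insert_iff, mem_singleton_iff, forall_eq_or_imp, forall_eq,
    not_or] at hdisj
  obtain ⟨⟨d1, d2⟩, ⟨d3, d4⟩⟩ := hdisj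
  have huK : u ∉ range e₁' ∪ range e₂' := by
    rintro (h | h)
    · rcases mem_range_cases hend₁' h with h | h | h <;> tauto
    · rcases mem_range_cases hend₂' h with h | h | h <;> tauto
  have hvK : v ∉ range e₁' ∪ range e₂' := by
    rintro (h | h)
    · rcases mem_range_cases hend₁' h with h | h | h <;> tauto
    · rcases mem_range_cases hend₂' h with h | h | h <;> tauto
  have hu'K : u' ∉ range e₁ ∪ range e₂ := by
    rintro (h | h)
    · rcases mem_range_cases hend₁ h with h | h | h
      exacts [a13 h, d1 h.symm, d3 h.symm]
    · rcases mem_range_cases hend₂ h with h | h | h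
      exacts [a23 h, d1 h.symm, d3 h.symm]
  have hv'K : v' ∉ range e₁ ∪ range e₂ := by
    rintro (h | h)
    · rcases mem_range_cases hend₁ h with h | h | h
      exacts [a14 h, d2 h.symm, d4 h.symm]
    · rcases mem_range_cases hend₂ h with h | h | h
      exacts [a24 h, d2 h.symm, d4 h.symm]
  set ℓ := connectedComponentIn (range e₁ ∪ range e₂)ᶜ x₁ with hℓdef
  set ℓ' := connectedComponentIn (range e₁' ∪ range e₂')ᶜ x₂ with hℓ'def
  have oℓ : IsOpen ℓ := hK.isOpen_compl.connectedComponentIn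
  have oℓ' : IsOpen ℓ' := hK'.isOpen_compl.connectedComponentIn
  have hfr : frontier (ℓ ∩ ℓ') ⊆ range e₁ ∪ range e₂ ∪ (range e₁' ∪ range e₂') := by
    intro z hz
    rcases frontier_inter_subset _ _ hz with h | h
    · rw [oℓ.frontier_eq] at h
      exact Or.inl ((closure_component hK h.1.1).resolve_right h.1.2)
    · rw [oℓ'.frontier_eq] at h
      exact Or.inr ((closure_component hK' h.2.1).resolve_right h.2.2)
  have hcl : ∀ z ∈ frontier (ℓ ∩ ℓ'), z ∈ closure ℓ ∧ z ∈ closure ℓ' := fun z hz =>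
    ⟨closure_mono inter_subset_left (frontier_subset_closure hz),
      closure_mono inter_subset_right (frontier_subset_closure hz)⟩
  have nu : u ∉ frontier (ℓ ∩ ℓ') := fun h =>
    (closure_component hK' (hcl _ h).2).elim huK huℓ'
  have nv : v ∉ frontier (ℓ ∩ ℓ') := fun h =>
    (closure_component hK' (hcl _ h).2).elim hvK hvℓ'
  have nu' : u' ∉ frontier (ℓ ∩ ℓ') := fun h =>
    (closure_component hK (hcl _ h).1).elim hu'K hu'ℓ
  have nv' : v' ∉ frontier (ℓ ∩ ℓ') := fun h =>
    (closure_component hK (hcl _ h).1).elim hv'K hv'ℓ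
  have hsub : ∀ {γ : unitInterval → ℝ × ℝ} {p q : ℝ × ℝ},
      ({γ 0, γ 1} : Set (ℝ × ℝ)) = {p, q} → p ∉ frontier (ℓ ∩ ℓ') → q ∉ frontier (ℓ ∩ ℓ') →
      range γ ∩ frontier (ℓ ∩ ℓ') ⊆ arcInt γ := by
    intro γ p q he hp hq z hz
    rcases mem_range_cases he hz.1 with h | h | h
    · exact h
    · exact (hp (h ▸ hz.2)).elim
    · exact (hq (h ▸ hz.2)).elim
  have f1 := hsub hend₁ nu nv
  have f2 := hsub hend₂ nu nv
  have f3 := hsub hend₁' nu' nv'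
  have f4 := hsub hend₂' nu' nv'
  have n13 : e₁ ≠ e₁' := by
    rintro rfl; exact (huK (Or.inl (by
      have : u ∈ ({e₁ 0, e₁ 1} : Set (ℝ × ℝ)) := by rw [hend₁]; simp
      rcases this with h | h <;> exact ⟨_, h.symm⟩)))
  have n14 : e₁ ≠ e₂' := by
    rintro rfl; exact (huK (Or.inr (by
      have : u ∈ ({e₁ 0, e₁ 1} : Set (ℝ × ℝ)) := by rw [hend₁]; simp
      rcases this with h | h <;> exact ⟨_, h.symm⟩)))
  have n23 : e₂ ≠ e₁' := by
    rintro rfl; exact (huK (Or.inl (by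
      have : u ∈ ({e₂ 0, e₂ 1} : Set (ℝ × ℝ)) := by rw [hend₂]; simp
      rcases this with h | h <;> exact ⟨_, h.symm⟩)))
  have n24 : e₂ ≠ e₂' := by
    rintro rfl; exact (huK (Or.inr (by
      have : u ∈ ({e₂ 0, e₂ 1} : Set (ℝ × ℝ)) := by rw [hend₂]; simp
      rcases this with h | h <;> exact ⟨_, h.symm⟩)))
  have s13 := hone e₁ (by simp) e₁' (by simp) n13
  have s14 := hone e₁ (by simp) e₂' (by simp) n14
  have s23 := hone e₂ (by simp) e₁' (by simp) n23
  have s24 := hone e₂ (by simp) e₂' (by simp) n24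
  have oF := oℓ.inter oℓ'
  have bF : Bornology.IsBounded (ℓ ∩ ℓ') := hℓbd.subset inter_subset_left
  have hx : x ∈ ℓ ∩ ℓ' := ⟨hxℓ, hxℓ'⟩
  obtain ⟨x1, x2⟩ := hxK
  obtain ⟨x3, x4⟩ := hxK'
  refine ⟨?_, ?_, ?_, ?_⟩
  · exact lens_core e₁ e₂ e₁' e₂' x _ hc₁ hc₂ hc₁' hc₂' hi₁ hi₂ hi₁' hi₂' oF bF hx
      x1 x2 x3 x4 f1 f2 f3 f4 hfr hnc hnc' s14 s24 s23
  · exact lens_core e₁ e₂ e₂' e₁' x _ hc₁ hc₂ hc₂' hc₁' hi₁ hi₂ hi₂' hi₁' oF bF hx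
      x1 x2 x4 x3 f1 f2 f4 f3 (by rwa [union_comm (range e₂')]) hnc hnc'.symm s13 s23 s24
  · exact lens_core e₂ e₁ e₁' e₂' x _ hc₂ hc₁ hc₁' hc₂' hi₂ hi₁ hi₁' hi₂' oF bF hx
      x2 x1 x3 x4 f2 f1 f3 f4 (by rwa [union_comm (range e₂)]) hnc.symm hnc' s24 s14 s13
  · exact lens_core e₂ e₁ e₂' e₁' x _ hc₂ hc₁ hc₂' hc₁' hi₂ hi₁ hi₂' hi₁' oF bF hx
      x2 x1 x4 x3 f2 f1 f4 f3 (by rwa [union_comm (range e₂), union_comm (range e₂')])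
      hnc.symm hnc'.symm s23 s13 s14
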